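/- Let x ∈ G, I = I(x), B = B(x), A = A(x). Suppose (ν, δ) ∈ ℝ^J × ℝ^{J+1} satisfies: δ_{J+1} = 0; δ_i ≥ 0 for i ∈ I, δ_i ≤ 0 for i ∈ B, δ_i = 0 for i ∉ I ∪ B; ν_i ≥ 0 for i ∈ A, ν_i = 0 for i ∉ A, Σ_{i∈A} ν_i = 1; and −ν_i β_i + δ_i − δ_{i+1} ≤ 0 for every i ∈ I (the inequality is NOT required for i ∉ I). Then, setting p = −Σ_{i∈A} ν_i b_i + δ (restricted to coordinates 1,…,J), the Hamiltonian satisfies H(p) = c + λ(1 − e^{Σ_i ν_i β_i − δ_1}) + Σ_{i=1}^J max(0, μ_i(1 − e^{−ν_i β_i + δ_i − δ_{i+1}})) ≥ 0. -/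

import Mathlib

open Real

noncomputable section

/-- Euclidean dot product on `ℝ^J`. -/
def dotJ {J : ℕ} (p q : Fin J → ℝ) : ℝ := ∑ j, p j * q j

/-- `γ_i = e_i − e_{i+1}` for `i < J`, and `γ_J = e_J` (0-indexed). -/
def gam (J : ℕ) (i : Fin J) : Fin J → ℝ :=
  fun j => (if j = i then (1 : ℝ) else 0) - (if (j : ℕ) = (i : ℕ) + 1 then (1 : ℝ) else 0)

/-- `b_i = β_i (e_1 + ⋯ + e_i)` (0-indexed: coordinates `j ≤ i`). -/
def bvec {J : ℕ} (β : Fin J → ℝ) (i : Fin J) : Fin J → ℝ :=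
  fun j => if (j : ℕ) ≤ (i : ℕ) then β i else 0

/-- The domain `G`. -/
def domG {J : ℕ} [NeZero J] (z : Fin J → ℝ) : Set (Fin J → ℝ) :=
  {x | (∀ i, 0 ≤ x i) ∧ x 0 < z 0 ∧ ∀ i : Fin J, i ≠ 0 → x i ≤ z i}

/-- The boundary portion `∂_o G`. -/
def bdO {J : ℕ} [NeZero J] (z : Fin J → ℝ) : Set (Fin J → ℝ) :=
  {x | x 0 = z 0 ∧ ∀ i : Fin J, i ≠ 0 → 0 ≤ x i ∧ x i ≤ z i}

/-- The boundary portion `∂_c G`. -/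
def bdC {J : ℕ} [NeZero J] (z : Fin J → ℝ) : Set (Fin J → ℝ) :=
  {x | x ∈ domG z ∧ ∃ i : Fin J, i ≠ 0 ∧ x i = z i}

/-- The Hamiltonian `H(p) = c + λ(1 − e^{−p_1}) + Σ_i max(0, μ_i(1 − e^{γ_i·p}))`. -/
def Ham {J : ℕ} [NeZero J] (lam c : ℝ) (μ : Fin J → ℝ) (p : Fin J → ℝ) : ℝ :=
  c + lam * (1 - Real.exp (-(p 0))) +
    ∑ i, max 0 (μ i * (1 - Real.exp (dotJ (gam J i) p)))

/-- Superdifferential of `V` at `x`, relative to the set `G`. -/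
def supDiff {J : ℕ} (G : Set (Fin J → ℝ)) (V : (Fin J → ℝ) → ℝ) (x : Fin J → ℝ) :
    Set (Fin J → ℝ) :=
  {p | ∀ ε > 0, ∃ r > 0, ∀ y ∈ G, ‖y - x‖ < r →
    V y - V x - dotJ p (y - x) ≤ ε * ‖y - x‖}

/-- Subdifferential of `V` at `x`, relative to the set `G`. -/
def subDiff {J : ℕ} (G : Set (Fin J → ℝ)) (V : (Fin J → ℝ) → ℝ) (x : Fin J → ℝ) :
    Set (Fin J → ℝ) :=
  {p | ∀ ε > 0, ∃ r > 0, ∀ y ∈ G, ‖y - x‖ < r →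
    -(ε * ‖y - x‖) ≤ V y - V x - dotJ p (y - x)}

/-- `A' = {i : μ_i ≤ μ_j for all j < i}`. -/
def Aprime {J : ℕ} (μ : Fin J → ℝ) : Set (Fin J) := {i | ∀ j, j < i → μ i ≤ μ j}

/-- `A(x) = {i ∈ A' : i+1 ∉ B(x), or every j > i with [i+1,j] ⊆ B(x) has μ_i < μ_j}`. -/
def Aset {J : ℕ} (μ z x : Fin J → ℝ) : Set (Fin J) :=
  {i | i ∈ Aprime μ ∧
    ((∀ h : (i : ℕ) + 1 < J, x ⟨(i : ℕ) + 1, h⟩ ≠ z ⟨(i : ℕ) + 1, h⟩) ∨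
      ∀ j : Fin J, i < j → (∀ k : Fin J, i < k → k ≤ j → x k = z k) → μ i < μ j)}

/-- `l(x) = x log x − x + 1` (finite branch; `Real.log 0 = 0` gives `0·log 0 = 0`). -/
def lfun (x : ℝ) : ℝ := x * Real.log x - x + 1

/-- The control set `U = [0,1]^J`. -/
def Uset (J : ℕ) : Set (Fin J → ℝ) := {u | ∀ i, 0 ≤ u i ∧ u i ≤ 1}

/-- The perturbation set `M = {(λ̄, μ̄) : λ̄ ≥ 0, μ̄_i ≥ 0}`. -/
def Mset (J : ℕ) : Set (ℝ × (Fin J → ℝ)) := {m | 0 ≤ m.1 ∧ ∀ i, 0 ≤ m.2 i}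

/-- `H(p,u,m) = c + p·(λ̄ e_1 − Σ_i u_i μ̄_i γ_i) + λ l(λ̄/λ) + Σ_i u_i μ_i l(μ̄_i/μ_i)`. -/
def Hpum {J : ℕ} [NeZero J] (lam c : ℝ) (μ : Fin J → ℝ) (p u : Fin J → ℝ)
    (m : ℝ × (Fin J → ℝ)) : ℝ :=
  c + dotJ p (fun j => m.1 * (if j = 0 then 1 else 0) - ∑ i, u i * m.2 i * gam J i j)
    + lam * lfun (m.1 / lam) + ∑ i, u i * (μ i * lfun (m.2 i / μ i))

/-- `h(ν,δ) = c + λ(1 − e^{Σ_i ν_i β_i − δ_1}) + Σ_i μ_i(1 − e^{−ν_i β_i + δ_i − δ_{i+1}})`,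
with `ν ∈ ℝ^J` and `δ ∈ ℝ^{J+1}`. -/
def hFun {J : ℕ} (lam c : ℝ) (μ β : Fin J → ℝ)
    (q : (Fin J → ℝ) × (Fin (J + 1) → ℝ)) : ℝ :=
  c + lam * (1 - Real.exp (∑ i, q.1 i * β i - q.2 0)) +
    ∑ i : Fin J, μ i * (1 - Real.exp (-(q.1 i * β i) + q.2 i.castSucc - q.2 i.succ))

/-- The constraint set `S` of pairs `(ν, δ)`. -/
def Sset {J : ℕ} (μ β z x : Fin J → ℝ) :
    Set ((Fin J → ℝ) × (Fin (J + 1) → ℝ)) :=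
  {q | q.2 (Fin.last J) = 0 ∧
    (∀ i : Fin J, x i = 0 → 0 ≤ q.2 i.castSucc) ∧
    (∀ i : Fin J, x i = z i → q.2 i.castSucc ≤ 0) ∧
    (∀ i : Fin J, x i ≠ 0 → x i ≠ z i → q.2 i.castSucc = 0) ∧
    (∀ i ∈ Aset μ z x, 0 ≤ q.1 i) ∧
    (∀ i ∉ Aset μ z x, q.1 i = 0) ∧
    (∑ i, q.1 i) = 1 ∧
    ∀ i : Fin J, -(q.1 i * β i) + q.2 i.castSucc - q.2 i.succ ≤ 0}

/-- `s` = largest (1-indexed) `j ≤ k` with `j ∉ I(x)`, and `s = 0` if none exists. -/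
def sIdx {J : ℕ} (x : Fin J → ℝ) (k : Fin J) : ℕ :=
  sSup (insert 0 ((fun j : Fin J => (j : ℕ) + 1) '' {j | j ≤ k ∧ x j ≠ 0}))

/-- `t` = least (1-indexed) `j ∈ [k+1, J]` with `j ∉ B(x)`, and `t = J+1` if none exists. -/
def tIdx {J : ℕ} (z x : Fin J → ℝ) (k : Fin J) : ℕ :=
  sInf (insert (J + 1) ((fun j : Fin J => (j : ℕ) + 1) '' {j | k < j ∧ x j ≠ z j}))

/-- `δ^{(r,k)}_i = β_k (1_{i ≥ r+1} − 1_{i ≥ k+1})` (1-indexed `i`, `r`; coordinates of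
`Fin (J+1)` are the 1-indexed positions shifted by one). -/
def delrk {J : ℕ} (β : Fin J → ℝ) (k : Fin J) (r : ℕ) : Fin (J + 1) → ℝ :=
  fun i => β k * ((if r ≤ (i : ℕ) then 1 else 0) - (if (k : ℕ) + 1 ≤ (i : ℕ) then 1 else 0))

theorem aux_exp (t y : ℝ) (h0 : 0 ≤ t) (h1 : t ≤ 1) :
    Real.exp (t * y) ≤ 1 - t + t * Real.exp y := by
  have := convexOn_exp.2 (Set.mem_univ (0:ℝ)) (Set.mem_univ y) (sub_nonneg.2 h1) h0 (by ring)
  simpa using this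

theorem aux_chord (a b : ℝ) (ha : 0 ≤ a) (hb : 0 < b) (hab : a ≤ b) :
    a / b * (1 - Real.exp (-b)) ≤ 1 - Real.exp (-a) := by
  have := aux_exp (a / b) (-b) (by positivity) ((div_le_one hb).2 hab)
  have e : a / b * -b = -a := by field_simp
  rw [e] at this
  linarith

theorem aux_q (lam c a b : ℝ) (hl : 0 < lam) (ha : 0 ≤ a) (hb : 0 < b)
    (hab : a ≤ b) :
    lam * (Real.exp a - 1) - c ≤
      a / b * (lam * (Real.exp b - 1) - c) - (1 - a / b) * c := by
  have := aux_exp (a / b) b (by positivity) ((div_le_one hb).2 hab)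
  have e : a / b * b = a := by field_simp
  rw [e] at this
  have := mul_le_mul_of_nonneg_left this hl.le
  linarith

theorem aux_psi (lam c a b : ℝ) (hl : 0 < lam) (hc : 0 < c) (ha : 0 < a)
    (hab : a ≤ b) :
    (lam * (Real.exp a - 1) - c) / a ≤ (lam * (Real.exp b - 1) - c) / b := by
  have hb : 0 < b := by linarith
  have h := aux_q lam c a b hl ha.le hb hab
  have h1 : 0 ≤ (1 - a / b) * c := mul_nonneg (sub_nonneg.2 ((div_le_one hb).2 hab)) hc.le
  rw [div_le_iff₀ ha]
  have e : (lam * (Real.exp b - 1) - c) / b * a = a / b * (lam * (Real.exp b - 1) - c) := by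
    ring
  rw [e]; linarith

theorem aux_beta (lam c μ₁ μ₂ a b : ℝ) (hl : 0 < lam) (hc : 0 < c) (hm : 0 < μ₁)
    (ha : 0 < a) (hb : 0 < b)
    (h1 : lam * (Real.exp a - 1) - c = μ₁ * (1 - Real.exp (-a)))
    (h2 : lam * (Real.exp b - 1) - c = μ₂ * (1 - Real.exp (-b)))
    (h : μ₁ ≤ μ₂) : a ≤ b := by
  by_contra hlt
  push Not at hlt
  have q := aux_q lam c b a hl hb.le ha hlt.le
  have r := aux_chord b a hb.le ha hlt.le
  have t1 : b / a < 1 := (div_lt_one ha).2 hlt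
  have p1 : 0 < (1 - b / a) * c := mul_pos (by linarith) hc
  have p2 : 0 ≤ 1 - Real.exp (-b) := by
    have := Real.exp_le_one_iff.2 (show -b ≤ 0 by linarith)
    linarith
  have p3 := mul_le_mul_of_nonneg_left r hm.le
  have p4 := mul_le_mul_of_nonneg_right h p2
  rw [h1] at q
  have e : b / a * (μ₁ * (1 - Real.exp (-a))) = μ₁ * (b / a * (1 - Real.exp (-a))) := by ring
  linarith

/-- Summation by parts. -/
theorem aux_parts (f δ : ℕ → ℝ) (n : ℕ) :
    ∑ r ∈ Finset.range (n + 1), f r * (δ (r + 1) - δ r) =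
      f n * δ (n + 1) - f 0 * δ 0 + ∑ i ∈ Finset.range n, δ (i + 1) * (f i - f (i + 1)) := by
  induction n with
  | zero => simp; ring
  | succ n ih => rw [Finset.sum_range_succ, ih, Finset.sum_range_succ _ n]; ring

theorem aux_flow (J : ℕ) (b ν β δ : ℕ → ℝ) (f : ℝ → ℝ)
    (h0 : δ 0 = 0) (hJ : δ J = 0)
    (hf : ∀ i < J, ∀ j < J, b i ≤ b j → f (b j) ≤ f (b i))
    (hp : ∀ i, i + 1 < J → 0 < δ (i + 1) → b (i + 1) ≤ b i)
    (hn : ∀ i, i + 1 < J → δ (i + 1) < 0 → b i ≤ b (i + 1)) :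
    ∑ r ∈ Finset.range J, f (b r) * (ν r * β r - δ r + δ (r + 1)) ≤
      ∑ r ∈ Finset.range J, f (b r) * (ν r * β r) := by
  cases J with
  | zero => simp
  | succ n =>
    have e : ∀ r, f (b r) * (ν r * β r - δ r + δ (r + 1)) =
        f (b r) * (ν r * β r) + f (b r) * (δ (r + 1) - δ r) := fun r => by ring
    simp_rw [e, Finset.sum_add_distrib]
    have := aux_parts (fun r => f (b r)) δ n
    rw [this, h0, hJ]
    have : ∑ i ∈ Finset.range n, δ (i + 1) * (f (b i) - f (b (i + 1))) ≤ 0 := by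
      apply Finset.sum_nonpos
      intro i hi
      have hi' : i + 1 < n + 1 := by simpa using hi
      rcases lt_trichotomy (δ (i + 1)) 0 with h | h | h
      · have := hf i (by omega) (i + 1) hi' (hn i hi' h)
        exact mul_nonpos_of_nonpos_of_nonneg h.le (by linarith)
      · simp [h]
      · have := hf (i + 1) hi' i (by omega) (hp i hi' h)
        exact mul_nonpos_of_nonneg_of_nonpos h.le (by linarith)
    linarith

open Classical in
/-- Nodes reachable from `r` along the flow. -/
def reach (J : ℕ) (δ : ℕ → ℝ) (r : ℕ) : Finset ℕ :=
  (Finset.range J).filter fun j =>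
    (j ≤ r ∧ ∀ i, j < i → i ≤ r → 0 < δ i) ∨ (r ≤ j ∧ ∀ i, r < i → i ≤ j → δ i < 0)

theorem self_mem_reach (J : ℕ) (δ : ℕ → ℝ) (r : ℕ) (hr : r < J) : r ∈ reach J δ r := by
  simp only [reach, Finset.mem_filter, Finset.mem_range]
  exact ⟨hr, Or.inl ⟨le_rfl, fun i h1 h2 => by omega⟩⟩

theorem exists_pot (J : ℕ) (β δ : ℕ → ℝ) :
    ∃ b : ℕ → ℝ, (∀ r < J, ∀ j ∈ reach J δ r, b r ≤ β j) ∧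
      (∀ r < J, ∃ j ∈ reach J δ r, b r = β j) := by
  have : ∀ r, ∃ v : ℝ, r < J → (∀ j ∈ reach J δ r, v ≤ β j) ∧ ∃ j ∈ reach J δ r, v = β j := by
    intro r
    by_cases hr : r < J
    · obtain ⟨j, hj, h⟩ := (reach J δ r).exists_min_image β ⟨r, self_mem_reach J δ r hr⟩
      exact ⟨β j, fun _ => ⟨h, j, hj, rfl⟩⟩
    · exact ⟨0, fun h => absurd h hr⟩
  choose b hb using this
  exact ⟨b, fun r hr => (hb r hr).1, fun r hr => (hb r hr).2⟩

theorem core (J : ℕ) (lam c : ℝ) (μ β ν δ : ℕ → ℝ) (hl : 0 < lam) (hc : 0 < c)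
    (hμ : ∀ i < J, 0 < μ i) (hβ : ∀ i < J, 0 < β i)
    (hq : ∀ i < J, lam * (Real.exp (β i) - 1) - c = μ i * (1 - Real.exp (-(β i))))
    (hν : ∀ i < J, 0 ≤ ν i) (hs : ∑ i ∈ Finset.range J, ν i ≤ 1)
    (h0 : δ 0 = 0) (hJ : δ J = 0)
    (ha : ∀ i < J, 0 ≤ ν i * β i - δ i + δ (i + 1))
    (hL : ∀ k < J, 0 < ν k → ∀ j < k, μ k ≤ μ j)
    (hR : ∀ k < J, 0 < ν k → ∀ j < J, k < j → (∀ i, k < i → i ≤ j → δ i < 0) → μ k ≤ μ j) :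
    0 ≤ c + lam * (1 - Real.exp (∑ i ∈ Finset.range J, ν i * β i)) +
      ∑ i ∈ Finset.range J, μ i * (1 - Real.exp (-(ν i * β i - δ i + δ (i + 1)))) := by
  obtain ⟨b, hb1, hb2⟩ := exists_pot J β δ
  have bpos : ∀ r < J, 0 < b r := by
    intro r hr
    obtain ⟨j, hj, e⟩ := hb2 r hr
    rw [e]
    simp only [reach, Finset.mem_filter, Finset.mem_range] at hj
    exact hβ j hj.1
  have ble : ∀ r < J, b r ≤ β r := fun r hr => hb1 r hr r (self_mem_reach J δ r hr)
  have beq : ∀ r < J, 0 < ν r → b r = β r := by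
    intro r hr hn
    refine le_antisymm (ble r hr) ?_
    obtain ⟨j, hj, e⟩ := hb2 r hr
    rw [e]
    simp only [reach, Finset.mem_filter, Finset.mem_range] at hj
    obtain ⟨hjJ, hj⟩ := hj
    refine aux_beta lam c (μ r) (μ j) _ _ hl hc (hμ r hr) (hβ r hr) (hβ j hjJ) (hq r hr)
      (hq j hjJ) ?_
    rcases lt_trichotomy j r with h | h | h
    · exact hL r hr hn j h
    · rw [h]
    · rcases hj with hj | hj
      · omega
      · exact hR r hr hn j hjJ h hj.2
  have hp : ∀ i, i + 1 < J → 0 < δ (i + 1) → b (i + 1) ≤ b i := by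
    intro i hi hd
    obtain ⟨j, hj, e⟩ := hb2 i (by omega)
    rw [e]
    apply hb1 (i + 1) hi
    simp only [reach, Finset.mem_filter, Finset.mem_range] at hj ⊢
    refine ⟨hj.1, Or.inl ?_⟩
    rcases hj.2 with h | h
    · refine ⟨by omega, fun k h1 h2 => ?_⟩
      rcases Nat.lt_or_ge i k with h3 | h3
      · have : k = i + 1 := by omega
        rw [this]; exact hd
      · exact h.2 k h1 h3
    · have : j = i := by
        by_contra hne
        have := h.2 (i + 1) (by omega) (by omega)
        linarith
      subst this
      refine ⟨by omega, fun k h1 h2 => ?_⟩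
      have : k = j + 1 := by omega
      rw [this]; exact hd
  have hn : ∀ i, i + 1 < J → δ (i + 1) < 0 → b i ≤ b (i + 1) := by
    intro i hi hd
    obtain ⟨j, hj, e⟩ := hb2 (i + 1) hi
    rw [e]
    apply hb1 i (by omega)
    simp only [reach, Finset.mem_filter, Finset.mem_range] at hj ⊢
    refine ⟨hj.1, Or.inr ?_⟩
    rcases hj.2 with h | h
    · have : j = i + 1 := by
        by_contra hne
        have := h.2 (i + 1) (by omega) (by omega)
        linarith
      subst this
      refine ⟨by omega, fun k h1 h2 => ?_⟩
      have : k = i + 1 := by omega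
      rw [this]; exact hd
    · refine ⟨by omega, fun k h1 h2 => ?_⟩
      rcases Nat.lt_or_ge (i + 1) k with h3 | h3
      · exact h.2 k h3 h2
      · have : k = i + 1 := by omega
        rw [this]; exact hd
  -- bound on the content of each node
  have hab : ∀ r < J, ν r * β r - δ r + δ (r + 1) ≤ b r := by
    intro r hr
    have F := aux_flow J b ν β δ (fun y => if y ≤ b r then 1 else 0) h0 hJ
      (by
        intro i _ j _ hij
        by_cases h : b j ≤ b r
        · have : b i ≤ b r := hij.trans h
          simp [h, this]
        · simp only [h, if_false]
          split_ifs <;> norm_num) hp hn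
    have S := Finset.single_le_sum (s := Finset.range J)
      (f := fun s => (if b s ≤ b r then (1:ℝ) else 0) * (ν s * β s - δ s + δ (s + 1)))
      (fun i hi => mul_nonneg (by split_ifs <;> norm_num) (ha i (Finset.mem_range.1 hi)))
      (Finset.mem_range.2 hr)
    simp only [le_refl, if_true, one_mul] at S
    have U : ∑ s ∈ Finset.range J, (if b s ≤ b r then (1:ℝ) else 0) * (ν s * β s) ≤
        ∑ s ∈ Finset.range J, ν s * b r := by
      apply Finset.sum_le_sum
      intro s hs
      have hs := Finset.mem_range.1 hs
      rcases (hν s hs).eq_or_lt with h | h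
      · simp [← h]
      · split_ifs with h'
        · rw [one_mul]
          rw [beq s hs h] at h'
          exact mul_le_mul_of_nonneg_left h' h.le
        · rw [zero_mul]
          exact mul_nonneg h.le (bpos r hr).le
    rw [← Finset.sum_mul] at U
    have V := mul_le_mul_of_nonneg_right hs (bpos r hr).le
    linarith
  -- flow of the potential
  have F := aux_flow J b ν β δ (fun y => -((lam * (Real.exp y - 1) - c) / y)) h0 hJ
      (fun i hi j _ hij => neg_le_neg (aux_psi lam c _ _ hl hc (bpos i hi) hij)) hp hn
  simp only [neg_mul, Finset.sum_neg_distrib, neg_le_neg_iff] at F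
  have A : ∑ r ∈ Finset.range J, (lam * (Real.exp (b r) - 1) - c) / b r *
        (ν r * β r - δ r + δ (r + 1)) ≤
      ∑ i ∈ Finset.range J, μ i * (1 - Real.exp (-(ν i * β i - δ i + δ (i + 1)))) := by
    apply Finset.sum_le_sum
    intro r hr
    have hr := Finset.mem_range.1 hr
    have h1 := mul_le_mul_of_nonneg_right (aux_psi lam c _ _ hl hc (bpos r hr) (ble r hr))
      (ha r hr)
    have h2 := mul_le_mul_of_nonneg_left
      (aux_chord _ _ (ha r hr) (hβ r hr) ((hab r hr).trans (ble r hr))) (hμ r hr).le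
    rw [hq r hr] at h1
    refine h1.trans (le_trans (le_of_eq ?_) h2)
    ring
  have B : ∑ r ∈ Finset.range J, (lam * (Real.exp (b r) - 1) - c) / b r * (ν r * β r) =
      ∑ r ∈ Finset.range J, ν r * (lam * (Real.exp (β r) - 1) - c) := by
    apply Finset.sum_congr rfl
    intro r hr
    have hr := Finset.mem_range.1 hr
    rcases (hν r hr).eq_or_lt with h | h
    · simp [← h]
    · rw [beq r hr h]
      have := (hβ r hr).ne'
      field_simp
  have Jn : Real.exp (∑ i ∈ Finset.range J, ν i * β i) ≤
      1 + ∑ i ∈ Finset.range J, ν i * (Real.exp (β i) - 1) := by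
    have := convexOn_exp.map_add_sum_le (t := Finset.range J) (w := ν) (p := β)
      (v := 1 - ∑ i ∈ Finset.range J, ν i) (q := 0)
      (fun i hi => hν i (Finset.mem_range.1 hi)) (by ring) (fun _ _ => Set.mem_univ _)
      (by linarith) (Set.mem_univ _)
    simp only [smul_eq_mul, mul_zero, zero_add, Real.exp_zero, mul_one] at this
    simp only [mul_sub, Finset.sum_sub_distrib, mul_one]
    linarith
  have C : ∑ r ∈ Finset.range J, ν r * (lam * (Real.exp (β r) - 1) - c) =
      lam * ∑ i ∈ Finset.range J, ν i * (Real.exp (β i) - 1) -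
        c * ∑ i ∈ Finset.range J, ν i := by
    rw [Finset.mul_sum, Finset.mul_sum, ← Finset.sum_sub_distrib]
    exact Finset.sum_congr rfl fun i _ => by ring
  have D := mul_le_mul_of_nonneg_left Jn hl.le
  have E := mul_le_mul_of_nonneg_left hs hc.le
  linarith

/-- Removal of the mass leaving through node `0`. -/
theorem core1 (J : ℕ) (lam c : ℝ) (μ β ν δ : ℕ → ℝ) (hl : 0 < lam) (hc : 0 < c)
    (hμ : ∀ i < J, 0 < μ i) (hβ : ∀ i < J, 0 < β i)
    (hq : ∀ i < J, lam * (Real.exp (β i) - 1) - c = μ i * (1 - Real.exp (-(β i))))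
    (hν : ∀ i < J, 0 ≤ ν i) (hs : ∑ i ∈ Finset.range J, ν i ≤ 1)
    (h0 : 0 ≤ δ 0) (hJ : δ J = 0)
    (ha : ∀ i < J, 0 ≤ ν i * β i - δ i + δ (i + 1))
    (hL : ∀ k < J, 0 < ν k → ∀ j < k, μ k ≤ μ j)
    (hR : ∀ k < J, 0 < ν k → ∀ j < J, k < j → (∀ i, k < i → i ≤ j → δ i < 0) → μ k ≤ μ j) :
    0 ≤ c + lam * (1 - Real.exp (∑ i ∈ Finset.range J, ν i * β i - δ 0)) +
      ∑ i ∈ Finset.range J, μ i * (1 - Real.exp (-(ν i * β i - δ i + δ (i + 1)))) := by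
  set g : ℕ → ℝ := fun i => δ 0 - ∑ k ∈ Finset.range i, ν k * β k with hg
  set d : ℕ → ℝ := fun i => max 0 (g i) with hd
  have gs : ∀ i, g (i + 1) = g i - ν i * β i := fun i => by
    simp only [hg, Finset.sum_range_succ]; ring
  have mnn : ∀ i < J, 0 ≤ ν i * β i := fun i hi => mul_nonneg (hν i hi) (hβ i hi).le
  have gle : ∀ i, i ≤ J → g i ≤ δ i := by
    intro i
    induction i with
    | zero => intro _; simp [hg]
    | succ i ih =>
      intro hi
      have := ih (by omega)
      have := ha i (by omega)
      rw [gs]; linarith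
  have ds : ∀ i < J, 0 ≤ d i - d (i + 1) ∧ d i - d (i + 1) ≤ ν i * β i := by
    intro i hi
    have := mnn i hi
    simp only [hd, gs]
    constructor
    · have := max_le_max_left 0 (show g i - ν i * β i ≤ g i by linarith)
      linarith
    · rcases le_total 0 (g i) with h | h
      · have := le_max_right 0 (g i - ν i * β i)
        rw [max_eq_right h]; linarith
      · have := le_max_left 0 (g i - ν i * β i)
        rw [max_eq_left h]; linarith
  set ν' : ℕ → ℝ := fun i => ν i - (d i - d (i + 1)) / β i with hν'
  have ν'm : ∀ i < J, ν' i * β i = ν i * β i - (d i - d (i + 1)) := fun i hi => by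
    have := (hβ i hi).ne'
    simp only [hν']; field_simp
  have ν'le : ∀ i < J, ν' i ≤ ν i := fun i hi => by
    have := div_nonneg (ds i hi).1 (hβ i hi).le
    simp only [hν']; linarith
  have dJ : d J = 0 := by
    have := gle J le_rfl
    simp only [hd]; exact max_eq_left (by linarith)
  have d0 : d 0 = δ 0 := by
    simp [hd, hg, h0]
  have ae : ∀ i < J, ν' i * β i - (δ i - d i) + (δ (i + 1) - d (i + 1)) =
      ν i * β i - δ i + δ (i + 1) := fun i hi => by rw [ν'm i hi]; ring
  have key := core J lam c μ β ν' (fun i => δ i - d i) hl hc hμ hβ hq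
    (fun i hi => by
      have := (ds i hi).2
      have := (div_le_iff₀ (hβ i hi)).2 this
      simp only [hν']; linarith)
    ((Finset.sum_le_sum fun i hi => ν'le i (Finset.mem_range.1 hi)).trans hs)
    (by simp [d0]) (by simp [dJ, hJ])
    (fun i hi => by rw [ae i hi]; exact ha i hi)
    (fun k hk hn => hL k hk (hn.trans_le (ν'le k hk)))
    (fun k hk hn j hj hkj h => hR k hk (hn.trans_le (ν'le k hk)) j hj hkj fun i h1 h2 => by
      have h3 := h i h1 h2
      have h4 := gle i (by omega)
      by_contra h5
      push Not at h5
      have : d i ≤ δ i := max_le h5 h4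
      linarith)
  have e1 : ∑ i ∈ Finset.range J, ν' i * β i = ∑ i ∈ Finset.range J, ν i * β i - δ 0 := by
    rw [Finset.sum_congr rfl fun i hi => ν'm i (Finset.mem_range.1 hi),
      Finset.sum_sub_distrib, Finset.sum_range_sub', dJ, d0, sub_zero]
  rw [e1] at key
  refine key.trans_eq (congrArg _ (Finset.sum_congr rfl fun i hi => ?_))
  rw [ae i (Finset.mem_range.1 hi)]

/-- Modified flow making all contents nonnegative. -/
def modFlow (m δ : ℕ → ℝ) : ℕ → ℝ
  | 0 => δ 0
  | i + 1 => max (δ (i + 1)) (modFlow m δ i - m i)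

theorem core2 (J : ℕ) (lam c : ℝ) (μ β ν δ : ℕ → ℝ) (hl : 0 < lam) (hc : 0 < c)
    (hμ : ∀ i < J, 0 < μ i) (hβ : ∀ i < J, 0 < β i)
    (hq : ∀ i < J, lam * (Real.exp (β i) - 1) - c = μ i * (1 - Real.exp (-(β i))))
    (hν : ∀ i < J, 0 ≤ ν i) (hs : ∑ i ∈ Finset.range J, ν i ≤ 1)
    (h0 : 0 ≤ δ 0) (hJ : δ J = 0)
    (ha : ∀ i < J, δ i ≤ 0 ∨ 0 ≤ ν i * β i - δ i + δ (i + 1))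
    (hL : ∀ k < J, 0 < ν k → ∀ j < k, μ k ≤ μ j)
    (hR : ∀ k < J, 0 < ν k → ∀ j < J, k < j → (∀ i, k < i → i ≤ j → δ i < 0) → μ k ≤ μ j) :
    0 ≤ c + lam * (1 - Real.exp (∑ i ∈ Finset.range J, ν i * β i - δ 0)) +
      ∑ i ∈ Finset.range J, max 0
        (μ i * (1 - Real.exp (-(ν i * β i) + δ i - δ (i + 1)))) := by
  set D := modFlow (fun i => ν i * β i) δ with hD
  have Ds : ∀ i, D (i + 1) = max (δ (i + 1)) (D i - ν i * β i) := fun i => rfl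
  have D0 : D 0 = δ 0 := rfl
  have Dge : ∀ i, δ i ≤ D i := by
    intro i
    cases i with
    | zero => exact le_rfl
    | succ i => rw [Ds]; exact le_max_left _ _
  have inv : ∀ i, i ≤ J → D i = δ i ∨ D i ≤ 0 := by
    intro i
    induction i with
    | zero => intro _; exact Or.inl rfl
    | succ i ih =>
      intro hi
      have hm : 0 ≤ ν i * β i := mul_nonneg (hν i (by omega)) (hβ i (by omega)).le
      rw [Ds]
      rcases le_total (D i - ν i * β i) (δ (i + 1)) with h | h
      · left; exact max_eq_left h
      · rw [max_eq_right h]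
        rcases ih (by omega) with e | e
        · rcases ha i (by omega) with h' | h'
          · right; linarith
          · left; linarith
        · right; linarith
  have DJ : D J = 0 := by
    rcases inv J le_rfl with h | h
    · rw [h, hJ]
    · have := Dge J
      linarith
  have key := core1 J lam c μ β ν D hl hc hμ hβ hq hν hs h0 DJ
    (fun i _ => by
      have := le_max_right (δ (i + 1)) (D i - ν i * β i)
      rw [Ds]; linarith)
    hL
    (fun k hk hn j hj hkj h => hR k hk hn j hj hkj fun i h1 h2 =>
      (Dge i).trans_lt (h i h1 h2))
  rw [D0] at key
  refine key.trans (add_le_add le_rfl (Finset.sum_le_sum fun i hi => ?_))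
  have hi := Finset.mem_range.1 hi
  have hm := (hμ i hi).le
  rw [Ds]
  rcases le_total (D i - ν i * β i) (δ (i + 1)) with h | h
  · rw [max_eq_left h]
    refine le_max_of_le_right (mul_le_mul_of_nonneg_left ?_ hm)
    have := Real.exp_le_exp.2 (show -(ν i * β i) + δ i - δ (i + 1) ≤
      -(ν i * β i - D i + δ (i + 1)) by linarith [Dge i])
    linarith
  · rw [max_eq_right h]
    refine le_max_of_le_left (le_of_eq ?_)
    have : -(ν i * β i - D i + (D i - ν i * β i)) = 0 := by ring
    rw [this]; simp

theorem dot_gam {J : ℕ} (i : Fin J) (p : Fin J → ℝ) :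
    dotJ (gam J i) p = p i - (if h : (i : ℕ) + 1 < J then p ⟨(i : ℕ) + 1, h⟩ else 0) := by
  unfold dotJ gam
  simp only [sub_mul, Finset.sum_sub_distrib, ite_mul, one_mul, zero_mul,
    Finset.sum_ite_eq', Finset.mem_univ, if_true]
  congr 1
  split_ifs with h
  · rw [Finset.sum_eq_single (⟨(i : ℕ) + 1, h⟩ : Fin J)]
    · simp
    · intro j _ hj
      rw [if_neg]
      intro h'; exact hj (Fin.ext h')
    · simp
  · apply Finset.sum_eq_zero
    intro j _
    rw [if_neg]
    have := j.2
    omega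

theorem ham_eq (J : ℕ) [NeZero J] (lam c : ℝ) (μ β : Fin J → ℝ)
    (ν : Fin J → ℝ) (δ : Fin (J + 1) → ℝ) (h1 : δ (Fin.last J) = 0) :
    Ham lam c μ (fun j => -(∑ i, ν i * bvec β i j) + δ j.castSucc) =
      c + lam * (1 - Real.exp (∑ i, ν i * β i - δ 0)) +
        (∑ i : Fin J,
          max 0 (μ i * (1 - Real.exp (-(ν i * β i) + δ i.castSucc - δ i.succ)))) := by
  unfold Ham
  have e0 : -(-(∑ i, ν i * bvec β i (0 : Fin J)) + δ (0 : Fin J).castSucc) =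
      ∑ i, ν i * β i - δ 0 := by
    have : (0 : Fin J).castSucc = 0 := by ext; simp
    rw [this]
    simp [bvec]
    ring
  rw [e0]
  congr 1
  refine Finset.sum_congr rfl fun i _ => ?_
  have e : dotJ (gam J i) (fun j => -(∑ i, ν i * bvec β i j) + δ j.castSucc) =
      -(ν i * β i) + δ i.castSucc - δ i.succ := by
    rw [dot_gam]
    have hsplit : ∀ k : Fin J, ν k * bvec β k i =
        (if k = i then ν k * β k else 0) +
          ν k * (if (i : ℕ) + 1 ≤ (k : ℕ) then β k else 0) := by
      intro k
      unfold bvec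
      by_cases hk : k = i
      · subst hk; simp
      · have : (k : ℕ) ≠ i := fun h => hk (Fin.ext h)
        by_cases h : (i : ℕ) ≤ k
        · rw [if_pos h, if_neg hk, if_pos (by omega)]; ring
        · rw [if_neg h, if_neg hk, if_neg (by omega)]; ring
    simp only [hsplit, Finset.sum_add_distrib, Finset.sum_ite_eq', Finset.mem_univ, if_true]
    split_ifs with h
    · have : (⟨(i : ℕ) + 1, h⟩ : Fin J).castSucc = i.succ := by ext; simp
      rw [this]
      simp only [bvec]
      ring
    · have hl : i.succ = Fin.last J := by
        ext; simp; have := i.2; omega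
      rw [hl, h1]
      have : ∑ k : Fin J, ν k * (if (i : ℕ) + 1 ≤ (k : ℕ) then β k else 0) = 0 := by
        apply Finset.sum_eq_zero
        intro k _
        rw [if_neg (by have := k.2; omega), mul_zero]
      rw [this]; ring
  rw [e]

/-- relaxed constraints — requiring `−ν_i β_i + δ_i − δ_{i+1} ≤ 0` only for
`i ∈ I(x)`, the Hamiltonian at `p = −Σ_i ν_i b_i + δ` equals
`c + λ(1 − e^{Σ ν_i β_i − δ_1}) + Σ_i max(0, μ_i(1 − e^{−ν_i β_i + δ_i − δ_{i+1}}))`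
and is nonnegative. -/
theorem stmt18 (J : ℕ) [NeZero J] (lam c : ℝ) (μ z β : Fin J → ℝ)
    (hlam : 0 < lam) (hc : 0 < c) (hμ : ∀ i, 0 < μ i) (hz : ∀ i, 0 < z i)
    (hβ : ∀ i, 0 < β i ∧
      c + lam * (1 - Real.exp (β i)) + μ i * (1 - Real.exp (-(β i))) = 0)
    (x : Fin J → ℝ) (hx : x ∈ domG z)
    (ν : Fin J → ℝ) (δ : Fin (J + 1) → ℝ)
    (h1 : δ (Fin.last J) = 0)
    (h2 : ∀ i : Fin J, x i = 0 → 0 ≤ δ i.castSucc)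
    (h3 : ∀ i : Fin J, x i = z i → δ i.castSucc ≤ 0)
    (h4 : ∀ i : Fin J, x i ≠ 0 → x i ≠ z i → δ i.castSucc = 0)
    (h5 : ∀ i ∈ Aset μ z x, 0 ≤ ν i) (h6 : ∀ i ∉ Aset μ z x, ν i = 0)
    (h7 : (∑ i, ν i) = 1)
    (h8 : ∀ i : Fin J, x i = 0 → -(ν i * β i) + δ i.castSucc - δ i.succ ≤ 0) :
    Ham lam c μ (fun j => -(∑ i, ν i * bvec β i j) + δ j.castSucc) =
      c + lam * (1 - Real.exp (∑ i, ν i * β i - δ 0)) +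
        (∑ i : Fin J,
          max 0 (μ i * (1 - Real.exp (-(ν i * β i) + δ i.castSucc - δ i.succ)))) ∧
    0 ≤ Ham lam c μ (fun j => -(∑ i, ν i * bvec β i j) + δ j.castSucc) := by
  have E := ham_eq J lam c μ β ν δ h1
  refine ⟨E, ?_⟩
  rw [E]
  have Jpos : 0 < J := Nat.pos_of_ne_zero (NeZero.ne J)
  -- extension to natural indices
  let ext : (Fin J → ℝ) → ℕ → ℝ := fun f n => if h : n < J then f ⟨n, h⟩ else 0
  let D : ℕ → ℝ := fun n => if h : n < J + 1 then δ ⟨n, h⟩ else 0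
  have ev : ∀ (f : Fin J → ℝ) (n : ℕ) (h : n < J), ext f n = f ⟨n, h⟩ := fun f n h => by
    simp [ext, h]
  have Dv : ∀ (n : ℕ) (h : n < J), D n = δ (⟨n, h⟩ : Fin J).castSucc := fun n h => by
    have : n < J + 1 := by omega
    simp only [D, this, dif_pos]; rfl
  have Dv' : ∀ (n : ℕ) (h : n < J), D (n + 1) = δ (⟨n, h⟩ : Fin J).succ := fun n h => by
    have : n + 1 < J + 1 := by omega
    simp only [D, this, dif_pos]; rfl
  have D0 : D 0 = δ 0 := by simp [D]
  have DJ : D J = 0 := by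
    have : D J = δ (Fin.last J) := by simp only [D, Nat.lt_succ_self, dif_pos]; rfl
    rw [this, h1]
  have negB : ∀ i : Fin J, δ i.castSucc < 0 → x i = z i := by
    intro i hi
    by_contra hne
    by_cases hx0 : x i = 0
    · have := h2 i hx0; linarith
    · have := h4 i hx0 hne; linarith
  have inA : ∀ i : Fin J, 0 < ν i → i ∈ Aset μ z x := by
    intro i hi
    by_contra h
    have := h6 i h; linarith
  have νnn : ∀ i : Fin J, 0 ≤ ν i := by
    intro i
    by_cases h : i ∈ Aset μ z x
    · exact h5 i h
    · exact (h6 i h).ge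
  have key := core2 J lam c (ext μ) (ext β) (ext ν) D hlam hc
    (fun i hi => by rw [ev _ i hi]; exact hμ _)
    (fun i hi => by rw [ev _ i hi]; exact (hβ _).1)
    (fun i hi => by rw [ev _ i hi, ev _ i hi]; linarith [(hβ ⟨i, hi⟩).2])
    (fun i hi => by rw [ev _ i hi]; exact νnn _)
    (by
      rw [← Fin.sum_univ_eq_sum_range]
      refine le_of_eq (Eq.trans (Finset.sum_congr rfl fun i _ => ?_) h7)
      rw [ev _ i i.2])
    (by
      by_contra h
      push Not at h
      rw [Dv 0 Jpos] at h
      have := negB _ h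
      have h' := hx.2.1
      have e : (⟨0, Jpos⟩ : Fin J) = 0 := by ext; simp
      rw [e] at this
      linarith)
    DJ
    (fun i hi => by
      rw [Dv i hi, Dv' i hi, ev _ i hi, ev _ i hi]
      by_cases h : x ⟨i, hi⟩ = 0
      · right; linarith [h8 _ h]
      · left
        by_cases h' : x ⟨i, hi⟩ = z ⟨i, hi⟩
        · exact h3 _ h'
        · exact (h4 _ h h').le)
    (fun k hk hn j hj => by
      rw [ev _ k hk] at hn
      rw [ev _ k hk, ev _ j (hj.trans hk)]
      exact (inA _ hn).1 _ hj)
    (fun k hk hn j hjJ hkj h => by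
      rw [ev _ k hk] at hn
      rw [ev _ k hk, ev _ j hjJ]
      rcases (inA _ hn).2 with h' | h'
      · exfalso
        have hk1 : k + 1 < J := by omega
        have := h (k + 1) (by omega) (by omega)
        rw [Dv (k + 1) hk1] at this
        exact h' hk1 (negB _ this)
      · refine (h' ⟨j, hjJ⟩ hkj fun i h3 h4 => ?_).le
        apply negB
        have := h i h3 h4
        rw [Dv i i.2] at this
        exact this)
  rw [← Fin.sum_univ_eq_sum_range (fun i => ext ν i * ext β i), D0,
    ← Fin.sum_univ_eq_sum_range (fun i => max 0
        (ext μ i * (1 - Real.exp (-(ext ν i * ext β i) + D i - D (i + 1)))))] at key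
  have e1 : ∀ i : Fin J, D i = δ i.castSucc := fun i => Dv i i.2
  have e2 : ∀ i : Fin J, D (i + 1) = δ i.succ := fun i => Dv' i i.2
  have e3 : ∀ (f : Fin J → ℝ) (i : Fin J), ext f i = f i := fun f i => ev f i i.2
  simp only [e1, e2, e3] at key
  exact key
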